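/- Let Q be a logic and A ⊆ Q. Then the sublogic L(A) = A^!! is isomorphic (as a complete orthomodular lattice) to the direct product of [0, com(A)] ∩ L(A) and [0, com(A)^⊥] ∩ L(A) (each with the induced order and relative orthocomplementation X ↦ X^⊥ ∧ E for the respective top element E); moreover [0, com(A)] ∩ L(A) is a complete Boolean algebra, and [0, com(A)^⊥] ∩ L(A) has no non-trivial Boolean factor, i.e., it has no nonzero central element F such that the interval [0, F] is distributive. -/

import Mathlib

/-- A *logic*: a complete orthomodular lattice. -/
class COL (Q : Type*) extends CompleteLattice Q where
  /-- orthocomplementation -/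
  oc : Q → Q
  oc_antitone : ∀ {P R : Q}, P ≤ R → oc R ≤ oc P
  oc_oc : ∀ P : Q, oc (oc P) = P
  sup_oc : ∀ P : Q, P ⊔ oc P = ⊤
  inf_oc : ∀ P : Q, P ⊓ oc P = ⊥
  orthomodular : ∀ {P R : Q}, P ≤ R → P ⊔ (oc P ⊓ R) = R

variable {Q : Type*} [COL Q]

/-- `P` commutes with `R`, written `P ∘ R` in the paper. -/
def COL.commutes (P R : Q) : Prop := P = (P ⊓ R) ⊔ (P ⊓ COL.oc R)

/-- The commutant `A^!` of a subset `A` of a logic. -/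
def COL.commutant (A : Set Q) : Set Q := {P : Q | ∀ R ∈ A, COL.commutes P R}

/-- The sublogic `L(A) = A^!!` generated by `A`. -/
def COL.Lgen (A : Set Q) : Set Q := COL.commutant (COL.commutant A)

/-- The center `Z(A) = A^! ∩ A^!!` of the sublogic generated by `A`. -/
def COL.Zcen (A : Set Q) : Set Q := COL.commutant A ∩ COL.Lgen A

/-- The set `S(A)` of subcommutators of `A`. -/
def COL.subcom (A : Set Q) : Set Q :=
  {E : Q | E ∈ COL.Zcen A ∧ ∀ P1 ∈ A, ∀ P2 ∈ A, COL.commutes (P1 ⊓ E) (P2 ⊓ E)}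

/-- Takeuti's commutator `com(A)`. -/
def COL.com (A : Set Q) : Q :=
  sSup {E : Q | E ∈ COL.commutant A ∧ ∀ P1 ∈ A, ∀ P2 ∈ A, COL.commutes (P1 ⊓ E) (P2 ⊓ E)}

/-- Relative commutativity in the interval `[0, e]` with relative orthocomplementation
`y ↦ oc y ⊓ e`. -/
def COL.relCommutes (e x y : Q) : Prop := x = (x ⊓ y) ⊔ (x ⊓ (COL.oc y ⊓ e))

namespace COL

theorem oc_sup (P R : Q) : oc (P ⊔ R) = oc P ⊓ oc R :=
  le_antisymm (le_inf (oc_antitone le_sup_left) (oc_antitone le_sup_right))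
    (by
      have h : P ⊔ R ≤ oc (oc P ⊓ oc R) := by
        refine sup_le ?_ ?_
        · simpa [oc_oc] using oc_antitone (inf_le_left : oc P ⊓ oc R ≤ oc P)
        · simpa [oc_oc] using oc_antitone (inf_le_right : oc P ⊓ oc R ≤ oc R)
      simpa [oc_oc] using oc_antitone h)

theorem oc_inf (P R : Q) : oc (P ⊓ R) = oc P ⊔ oc R := by
  rw [← oc_oc (oc P ⊔ oc R), oc_sup, oc_oc, oc_oc]

theorem oc_sSup (S : Set Q) : oc (sSup S) = sInf (oc '' S) := by
  refine le_antisymm ?_ ?_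
  · refine le_sInf ?_
    rintro _ ⟨x, hx, rfl⟩
    exact oc_antitone (le_sSup hx)
  · have h : sSup S ≤ oc (sInf (oc '' S)) := sSup_le fun x hx => by
      simpa [oc_oc] using oc_antitone (sInf_le (Set.mem_image_of_mem oc hx))
    simpa [oc_oc] using oc_antitone h

theorem oc_sInf (S : Set Q) : oc (sInf S) = sSup (oc '' S) := by
  rw [← oc_oc (sSup (oc '' S)), oc_sSup, Set.image_image]
  simp [oc_oc]

theorem commutes_iff_le {P R : Q} : commutes P R ↔ P ≤ (P ⊓ R) ⊔ (P ⊓ oc R) :=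
  ⟨fun h => h.le, fun h => le_antisymm h (sup_le inf_le_left inf_le_left)⟩

theorem commutes_of_le {P R : Q} (h : P ≤ R) : commutes P R :=
  commutes_iff_le.2 ((le_inf le_rfl h).trans le_sup_left)

theorem commutes_of_le_oc {P R : Q} (h : P ≤ oc R) : commutes P R :=
  commutes_iff_le.2 ((le_inf le_rfl h).trans le_sup_right)

theorem commutes.inf_oc_inf_le {P R : Q} (h : commutes P R) : R ⊓ oc (R ⊓ P) ≤ oc P := by
  have h' : oc P = (oc P ⊔ oc R) ⊓ (oc P ⊔ R) := by
    conv_lhs => rw [h]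
    rw [oc_sup, oc_inf, oc_inf, oc_oc]
  rw [h', oc_inf, sup_comm (oc R)]
  exact le_inf inf_le_right (inf_le_left.trans le_sup_right)

theorem commutes.symm {P R : Q} (h : commutes P R) : commutes R P := by
  refine commutes_iff_le.2 ?_
  conv_lhs => rw [← orthomodular (inf_le_left : R ⊓ P ≤ R)]
  exact sup_le_sup_left (le_inf inf_le_right (inf_comm (oc (R ⊓ P)) R ▸ h.inf_oc_inf_le)) _

theorem commutes.oc_right {P R : Q} (h : commutes P R) : commutes P (oc R) := by
  rw [commutes, oc_oc, sup_comm]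
  exact h

theorem commutes.oc_left {P R : Q} (h : commutes P R) : commutes (oc P) R :=
  h.symm.oc_right.symm

theorem commutes_sSup_left {S : Set Q} {R : Q} (h : ∀ P ∈ S, commutes P R) :
    commutes (sSup S) R :=
  commutes_iff_le.2 <| sSup_le fun P hP => (h P hP).le.trans <|
    sup_le_sup (inf_le_inf_right _ (le_sSup hP)) (inf_le_inf_right _ (le_sSup hP))

theorem commutes_sInf_left {S : Set Q} {R : Q} (h : ∀ P ∈ S, commutes P R) :
    commutes (sInf S) R := by
  rw [← oc_oc (sInf S), oc_sInf]
  refine (commutes_sSup_left ?_).oc_left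
  rintro _ ⟨P, hP, rfl⟩
  exact (h P hP).oc_left

theorem commutes.sup_left {P P' R : Q} (h : commutes P R) (h' : commutes P' R) :
    commutes (P ⊔ P') R := by
  rw [← sSup_pair]
  exact commutes_sSup_left (by rintro _ (rfl | rfl) <;> assumption)

theorem commutes.inf_left {P P' R : Q} (h : commutes P R) (h' : commutes P' R) :
    commutes (P ⊓ P') R := by
  rw [← sInf_pair]
  exact commutes_sInf_left (by rintro _ (rfl | rfl) <;> assumption)

theorem commutes.sup_right {P R R' : Q} (h : commutes P R) (h' : commutes P R') :
    commutes P (R ⊔ R') :=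
  (h.symm.sup_left h'.symm).symm

theorem commutes.inf_right {P R R' : Q} (h : commutes P R) (h' : commutes P R') :
    commutes P (R ⊓ R') :=
  (h.symm.inf_left h'.symm).symm

/-- The Foulis–Holland distributive law. -/
theorem commutes.inf_sup_eq {P R R' : Q} (h : commutes P R) (h' : commutes P R') :
    P ⊓ (R ⊔ R') = (P ⊓ R) ⊔ (P ⊓ R') := by
  have hle : (P ⊓ R) ⊔ (P ⊓ R') ≤ P ⊓ (R ⊔ R') :=
    sup_le (inf_le_inf_left _ le_sup_left) (inf_le_inf_left _ le_sup_right)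
  have hbot : oc ((P ⊓ R) ⊔ (P ⊓ R')) ⊓ (P ⊓ (R ⊔ R')) ≤ ⊥ := by
    rw [← inf_oc (R ⊔ R'), oc_sup, oc_sup]
    refine le_inf (inf_le_right.trans inf_le_right) (le_inf ?_ ?_)
    · refine le_trans ?_ h.symm.inf_oc_inf_le
      exact le_inf (inf_le_right.trans inf_le_left) (inf_le_left.trans inf_le_left)
    · refine le_trans ?_ h'.symm.inf_oc_inf_le
      exact le_inf (inf_le_right.trans inf_le_left) (inf_le_left.trans inf_le_right)
  have := orthomodular hle
  rwa [le_bot_iff.1 hbot, sup_bot_eq, eq_comm] at this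

theorem commutes.inf_sup_inf_oc {P R : Q} (h : commutes P R) : (P ⊓ R) ⊔ (P ⊓ oc R) = P :=
  Eq.symm h

/-- To commute with `R` it suffices to commute with both parts of `R` cut out by some `E`. -/
theorem commutes_of_commutes_inf {P R E : Q} (hE : commutes R E) (h : commutes P (R ⊓ E))
    (h' : commutes P (R ⊓ oc E)) : commutes P R := by
  rw [← hE.inf_sup_inf_oc]
  exact h.sup_right h'

/-- An element below `E` commutes with `R` as soon as it commutes with `R ⊓ E`. -/
theorem commutes_of_le_of_commutes_inf {P R E : Q} (hE : commutes R E) (hP : P ≤ E)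
    (h : commutes P (R ⊓ E)) : commutes P R :=
  commutes_of_commutes_inf hE h <| commutes_of_le_oc <| by
    rw [oc_inf, oc_oc]
    exact hP.trans le_sup_right

/-- The commutator of a pair of elements. -/
def pairCom (P R : Q) : Q :=
  ((P ⊓ R) ⊔ (P ⊓ oc R)) ⊔ ((oc P ⊓ R) ⊔ (oc P ⊓ oc R))

theorem commutes.pairCom_right {B P R : Q} (hP : commutes B P) (hR : commutes B R) :
    commutes B (pairCom P R) :=
  ((hP.inf_right hR).sup_right (hP.inf_right hR.oc_right)).sup_right
    ((hP.oc_right.inf_right hR).sup_right (hP.oc_right.inf_right hR.oc_right))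

/-- The commutator of `P` and `R` bounds the elements commuting with `P` and `R` below which
`P` and `R` commute. -/
theorem commutes_inf_inf_iff {P R E : Q} (hP : commutes E P) (hR : commutes E R) :
    commutes (P ⊓ E) (R ⊓ E) ↔ E ≤ pairCom P R := by
  constructor
  · intro h
    have h1 : commutes (P ⊓ E) R := commutes_of_le_of_commutes_inf hR.symm inf_le_right h
    have h2 : commutes (oc P ⊓ E) R := by
      have : oc P ⊓ E = E ⊓ oc (P ⊓ E) := by
        rw [oc_inf, hP.oc_right.inf_sup_eq (commutes_of_le le_rfl).oc_right, inf_oc,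
          sup_bot_eq, inf_comm]
      rw [this]
      exact hR.inf_left h1.oc_left
    rw [← hP.inf_sup_inf_oc, inf_comm E, inf_comm E]
    refine sup_le_sup (h1.le.trans ?_) (h2.le.trans ?_) <;>
      exact sup_le_sup (inf_le_inf_right _ inf_le_left) (inf_le_inf_right _ inf_le_left)
  · intro h
    have hPP : commutes P P := commutes_of_le le_rfl
    have key : P ⊓ pairCom P R ≤ (P ⊓ R) ⊔ (P ⊓ oc R) := by
      have c1 : commutes P ((P ⊓ R) ⊔ (P ⊓ oc R)) :=
        (commutes_of_le (sup_le inf_le_left inf_le_left)).symm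
      have c2 : commutes P ((oc P ⊓ R) ⊔ (oc P ⊓ oc R)) :=
        (commutes_of_le_oc (sup_le inf_le_left inf_le_left)).symm
      rw [pairCom, c1.inf_sup_eq c2]
      refine sup_le inf_le_right (le_trans ?_ bot_le)
      rw [← inf_oc P]
      exact inf_le_inf_left _ (sup_le inf_le_left inf_le_left)
    have hER : commutes (P ⊓ E) R := by
      refine commutes_iff_le.2 ?_
      calc P ⊓ E ≤ E ⊓ ((P ⊓ R) ⊔ (P ⊓ oc R)) :=
            le_inf inf_le_right ((inf_le_inf_left _ h).trans key)
        _ = (E ⊓ (P ⊓ R)) ⊔ (E ⊓ (P ⊓ oc R)) :=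
            (hP.inf_right hR).inf_sup_eq (hP.inf_right hR.oc_right)
        _ = ((P ⊓ E) ⊓ R) ⊔ ((P ⊓ E) ⊓ oc R) := by
            rw [← inf_assoc, ← inf_assoc, inf_comm E]
    exact hER.inf_right (commutes_of_le inf_le_right)

section commutant

variable {A : Set Q} {x y : Q}

theorem oc_mem_commutant (hx : x ∈ commutant A) : oc x ∈ commutant A :=
  fun R hR => (hx R hR).oc_left

theorem inf_mem_commutant (hx : x ∈ commutant A) (hy : y ∈ commutant A) : x ⊓ y ∈ commutant A :=
  fun R hR => (hx R hR).inf_left (hy R hR)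

theorem sup_mem_commutant (hx : x ∈ commutant A) (hy : y ∈ commutant A) : x ⊔ y ∈ commutant A :=
  fun R hR => (hx R hR).sup_left (hy R hR)

theorem subset_Lgen (A : Set Q) : A ⊆ Lgen A :=
  fun _ hP _ hB => (hB _ hP).symm

theorem com_mem_commutant (A : Set Q) : com A ∈ commutant A :=
  fun R hR => commutes_sSup_left fun _ hE => hE.1 R hR

theorem le_com {E : Q} (hE : E ∈ commutant A)
    (h : ∀ P ∈ A, ∀ R ∈ A, E ≤ pairCom P R) : E ≤ com A :=
  le_sSup ⟨hE, fun P hP R hR => (commutes_inf_inf_iff (hE P hP) (hE R hR)).2 (h P hP R hR)⟩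

theorem com_le_pairCom {P R : Q} (hP : P ∈ A) (hR : R ∈ A) : com A ≤ pairCom P R :=
  sSup_le fun _ hE => (commutes_inf_inf_iff (hE.1 P hP) (hE.1 R hR)).1 (hE.2 P hP R hR)

theorem commutes_inf_com {P R : Q} (hP : P ∈ A) (hR : R ∈ A) :
    commutes (P ⊓ com A) (R ⊓ com A) :=
  (commutes_inf_inf_iff (com_mem_commutant A P hP) (com_mem_commutant A R hR)).2
    (com_le_pairCom hP hR)

theorem com_mem_Lgen (A : Set Q) : com A ∈ Lgen A := by
  intro B hB
  have hle : B ⊓ (oc B ⊔ com A) ≤ com A := by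
    refine le_com
      (inf_mem_commutant hB (sup_mem_commutant (oc_mem_commutant hB) (com_mem_commutant A))) ?_
    intro P hP R hR
    have hX : commutes B (pairCom P R) := (hB P hP).pairCom_right (hB R hR)
    calc B ⊓ (oc B ⊔ com A) ≤ B ⊓ (oc B ⊔ pairCom P R) :=
          inf_le_inf_left _ (sup_le_sup_left (com_le_pairCom hP hR) _)
      _ = (B ⊓ oc B) ⊔ (B ⊓ pairCom P R) :=
          (commutes_of_le le_rfl).oc_right.inf_sup_eq hX
      _ ≤ pairCom P R := by
          rw [inf_oc, bot_sup_eq]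
          exact inf_le_right
  refine commutes.symm (commutes_iff_le.2 ?_)
  have h1 : B ⊓ oc (B ⊓ oc (com A)) ≤ B ⊓ com A := by
    rw [oc_inf, oc_oc]
    exact le_inf inf_le_left hle
  have h2 := orthomodular (inf_le_left : B ⊓ oc (com A) ≤ B)
  rw [inf_comm (oc _) B] at h2
  conv_lhs => rw [← h2, sup_comm]
  exact sup_le_sup_right h1 _

theorem commutes_com (hx : x ∈ Lgen A) : commutes x (com A) :=
  hx _ (com_mem_commutant A)

theorem mem_commutant_of_le_com (hx : x ∈ Lgen A) (hxc : x ≤ com A) : x ∈ commutant A := by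
  intro P hP
  have hPc := com_mem_commutant A P hP
  refine commutes_of_le_of_commutes_inf hPc.symm hxc (hx _ ?_)
  exact fun R hR => commutes_of_le_of_commutes_inf (com_mem_commutant A R hR).symm inf_le_right
    (commutes_inf_com hP hR)

/-- If `u ≤ E` and `v ≤ oc E`, then `u` is the part of `u ⊔ v` below `E`. -/
theorem sup_inf_eq_left {u v E : Q} (hu : u ≤ E) (hv : v ≤ oc E) : (u ⊔ v) ⊓ E = u := by
  have hv' : E ⊓ v = ⊥ := le_bot_iff.1 ((inf_le_inf_left E hv).trans_eq (inf_oc E))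
  rw [inf_comm, (commutes_of_le hu).symm.inf_sup_eq (commutes_of_le_oc hv).symm, hv', sup_bot_eq,
    inf_eq_right.2 hu]

theorem oc_inf_eq_oc_inf_inf {E : Q} (h : commutes x E) : oc x ⊓ E = oc (x ⊓ E) ⊓ E := by
  rw [oc_inf, inf_comm (_ ⊔ _), h.symm.oc_right.inf_sup_eq (commutes_of_le le_rfl).oc_right,
    inf_oc, sup_bot_eq, inf_comm]

/-- The decomposition of `Lgen A` along an element commuting with all of it. -/
def LgenDecomp (A : Set Q) (E : Q) (hE : E ∈ Lgen A) (hc : ∀ x ∈ Lgen A, commutes x E) :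
    {x : Q // x ∈ Lgen A} ≃o
      ({x : Q // x ∈ Lgen A ∧ x ≤ E} × {x : Q // x ∈ Lgen A ∧ x ≤ oc E}) where
  toFun x := (⟨x ⊓ E, inf_mem_commutant x.2 hE, inf_le_right⟩,
    ⟨x ⊓ oc E, inf_mem_commutant x.2 (oc_mem_commutant hE), inf_le_right⟩)
  invFun p := ⟨p.1 ⊔ p.2, sup_mem_commutant p.1.2.1 p.2.2.1⟩
  left_inv x := Subtype.ext (hc x x.2).inf_sup_inf_oc
  right_inv p := Prod.ext (Subtype.ext (sup_inf_eq_left p.1.2.2 p.2.2.2))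
    (Subtype.ext <| (congrArg (· ⊓ oc E) (sup_comm (p.1 : Q) p.2)).trans
      (sup_inf_eq_left p.2.2.2 (p.1.2.2.trans (oc_oc E).ge)))
  map_rel_iff' := by
    intro x y
    refine ⟨fun h => ?_, fun h => ⟨inf_le_inf_right E h, inf_le_inf_right (oc E) h⟩⟩
    have h1 : (x : Q) ⊓ E ≤ (y : Q) ⊓ E := h.1
    have h2 : (x : Q) ⊓ oc E ≤ (y : Q) ⊓ oc E := h.2
    exact (hc x x.2).le.trans (sup_le (h1.trans inf_le_left) (h2.trans inf_le_left))

end commutant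

end COL

/-- Theorem 2.7: `L(A)` factors as the direct product of the complete Boolean algebra
`[0, com(A)] ∩ L(A)` and the complete orthomodular lattice `[0, com(A)^⊥] ∩ L(A)`,
which has no non-trivial Boolean factor. -/
theorem stmt6 (A : Set Q) :
    -- (1) L(A) is isomorphic to the direct product of the two intervals,
    --     by an order isomorphism respecting the (relative) orthocomplementations
    (∃ φ : {x : Q // x ∈ COL.Lgen A} ≃o
        ({x : Q // x ∈ COL.Lgen A ∧ x ≤ COL.com A} ×
         {x : Q // x ∈ COL.Lgen A ∧ x ≤ COL.oc (COL.com A)}),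
      ∀ (x : {x : Q // x ∈ COL.Lgen A}) (hx : COL.oc (x : Q) ∈ COL.Lgen A),
        (((φ ⟨COL.oc (x : Q), hx⟩).1 : Q) = COL.oc ((φ x).1 : Q) ⊓ COL.com A) ∧
        (((φ ⟨COL.oc (x : Q), hx⟩).2 : Q) = COL.oc ((φ x).2 : Q) ⊓ COL.oc (COL.com A)))
    -- (2) [0, com(A)] ∩ L(A) is a complete Boolean algebra (i.e. distributive)
    ∧ (∀ x y z : Q, x ∈ COL.Lgen A → y ∈ COL.Lgen A → z ∈ COL.Lgen A →
        x ≤ COL.com A → y ≤ COL.com A → z ≤ COL.com A →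
        x ⊓ (y ⊔ z) = (x ⊓ y) ⊔ (x ⊓ z))
    -- (3) [0, com(A)^⊥] ∩ L(A) has no non-trivial Boolean factor: no nonzero central
    --     element F with distributive interval [0, F]
    ∧ ¬ ∃ F : Q, F ∈ COL.Lgen A ∧ F ≤ COL.oc (COL.com A) ∧ F ≠ ⊥ ∧
        (∀ x : Q, x ∈ COL.Lgen A → x ≤ COL.oc (COL.com A) →
          COL.relCommutes (COL.oc (COL.com A)) x F) ∧
        (∀ x y z : Q, x ∈ COL.Lgen A → y ∈ COL.Lgen A → z ∈ COL.Lgen A →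
          x ≤ F → y ≤ F → z ≤ F → x ⊓ (y ⊔ z) = (x ⊓ y) ⊔ (x ⊓ z)) := by
  have hc := COL.com_mem_commutant A
  have hL := COL.com_mem_Lgen A
  refine ⟨⟨COL.LgenDecomp A (COL.com A) hL fun x hx => COL.commutes_com hx, fun x _ =>
    ⟨COL.oc_inf_eq_oc_inf_inf (COL.commutes_com x.2),
      COL.oc_inf_eq_oc_inf_inf (COL.commutes_com x.2).oc_right⟩⟩, ?_, ?_⟩
  · intro x y z hx hy hz hxc _ _
    have hx' := COL.mem_commutant_of_le_com hx hxc
    exact (hy x hx').symm.inf_sup_eq (hz x hx').symm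
  · rintro ⟨F, hF, hFc, hF0, hcentral, hdistrib⟩
    have hFA : F ∈ COL.commutant A := by
      intro P hP
      refine COL.commutes_of_le_of_commutes_inf (hc P hP).symm.oc_right hFc ?_
      have h := hcentral (P ⊓ COL.oc (COL.com A))
        (COL.inf_mem_commutant (COL.subset_Lgen A hP) (COL.oc_mem_commutant hL)) inf_le_right
      exact COL.commutes.symm (COL.commutes_iff_le.2 (h.le.trans
        (sup_le_sup_left (inf_le_inf_left _ inf_le_left) _)))
    have hFcom : F ≤ COL.com A := by
      refine le_sSup ⟨hFA, fun P hP R hR => COL.commutes_iff_le.2 ?_⟩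
      have hPL := COL.inf_mem_commutant (COL.subset_Lgen A hP) hF
      have hRL := COL.inf_mem_commutant (COL.subset_Lgen A hR) hF
      have hRF := COL.orthomodular (inf_le_right : R ⊓ F ≤ F)
      have h := hdistrib (P ⊓ F) (R ⊓ F) (COL.oc (R ⊓ F) ⊓ F) hPL hRL
        (COL.inf_mem_commutant (COL.oc_mem_commutant hRL) hF)
        inf_le_right inf_le_right inf_le_right
      rw [hRF, inf_assoc, inf_idem] at h
      exact h.le.trans (sup_le_sup_left (inf_le_inf_left _ inf_le_left) _)
    exact hF0 (le_bot_iff.1 ((le_inf hFcom hFc).trans_eq (COL.inf_oc _)))
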